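/- Let z₁, z₂, z₃ ∈ ℂ be such that 𝔠₁₂ ≠ 0. Then (C₆, C₉, C₁₂) ≠ 0 and the invariants are recovered from Jacobians by: C₆ = (2/3)·(C₆, C₉, C₁₈)/(C₆, C₉, C₁₂); C₉ = −(1/432)·(C₆, C₁₂, C₁₈)/(C₆, C₉, C₁₂); C₁₂ = (2/3)·(C₉, C₁₂, C₁₈)/(C₆, C₉, C₁₂) + (4/9)·(C₆, C₉, C₁₈)²/(C₆, C₉, C₁₂)². -/

import Mathlib

noncomputable section

/-- Hessian invariant C₆. -/
def C₆ : ℂ → ℂ → ℂ → ℂ := fun z₁ z₂ z₃ =>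
  z₁^6 + z₂^6 + z₃^6 - 10*(z₁^3*z₂^3 + z₂^3*z₃^3 + z₃^3*z₁^3)
/-- Hessian invariant C₉. -/
def C₉ : ℂ → ℂ → ℂ → ℂ := fun z₁ z₂ z₃ =>
  (z₁^3 - z₂^3)*(z₂^3 - z₃^3)*(z₃^3 - z₁^3)
/-- Hessian invariant C₁₂. -/
def C₁₂ : ℂ → ℂ → ℂ → ℂ := fun z₁ z₂ z₃ =>
  (z₁^3 + z₂^3 + z₃^3)*((z₁^3 + z₂^3 + z₃^3)^3 + 216*z₁^3*z₂^3*z₃^3)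
/-- Hessian invariant 𝔠₁₂. -/
def 𝔠₁₂ : ℂ → ℂ → ℂ → ℂ := fun z₁ z₂ z₃ =>
  z₁*z₂*z₃*(27*z₁^3*z₂^3*z₃^3 - (z₁^3 + z₂^3 + z₃^3)^3)
/-- Hessian invariant C₁₈. -/
def C₁₈ : ℂ → ℂ → ℂ → ℂ := fun z₁ z₂ z₃ =>
  (z₁^3 + z₂^3 + z₃^3)^6 - 540*z₁^3*z₂^3*z₃^3*(z₁^3 + z₂^3 + z₃^3)^3 - 5832*z₁^6*z₂^6*z₃^6

/-- Complex partial derivative in the first variable. -/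
def pd₁ (F : ℂ → ℂ → ℂ → ℂ) (z₁ z₂ z₃ : ℂ) : ℂ := deriv (fun t => F t z₂ z₃) z₁
/-- Complex partial derivative in the second variable. -/
def pd₂ (F : ℂ → ℂ → ℂ → ℂ) (z₁ z₂ z₃ : ℂ) : ℂ := deriv (fun t => F z₁ t z₃) z₂
/-- Complex partial derivative in the third variable. -/
def pd₃ (F : ℂ → ℂ → ℂ → ℂ) (z₁ z₂ z₃ : ℂ) : ℂ := deriv (fun t => F z₁ z₂ t) z₃

/-- Jacobian determinant of three functions of (z₁, z₂, z₃). -/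
def jac (F G H : ℂ → ℂ → ℂ → ℂ) (z₁ z₂ z₃ : ℂ) : ℂ :=
  Matrix.det !![pd₁ F z₁ z₂ z₃, pd₂ F z₁ z₂ z₃, pd₃ F z₁ z₂ z₃;
                pd₁ G z₁ z₂ z₃, pd₂ G z₁ z₂ z₃, pd₃ G z₁ z₂ z₃;
                pd₁ H z₁ z₂ z₃, pd₂ H z₁ z₂ z₃, pd₃ H z₁ z₂ z₃]

/-- The syzygy expressing `C₁₈` through `C₆`, `C₉`, `C₁₂`. -/
theorem C₁₈_eq (z₁ z₂ z₃ : ℂ) : C₁₈ z₁ z₂ z₃ =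
    216 * C₉ z₁ z₂ z₃ ^ 2 - C₆ z₁ z₂ z₃ ^ 3 / 2 + 3 / 2 * (C₆ z₁ z₂ z₃ * C₁₂ z₁ z₂ z₃) := by
  simp only [C₆, C₉, C₁₂, C₁₈]
  ring

theorem deriv_syzygy {f g h : ℂ → ℂ} (z : ℂ) (hf : Differentiable ℂ f) (hg : Differentiable ℂ g)
    (hh : Differentiable ℂ h) :
    deriv (fun t => 216 * g t ^ 2 - f t ^ 3 / 2 + 3 / 2 * (f t * h t)) z =
      3 / 2 * (h z - f z ^ 2) * deriv f z + 432 * g z * deriv g z + 3 / 2 * f z * deriv h z := by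
  have hf := (hf z).hasDerivAt
  have hg := (hg z).hasDerivAt
  have hh := (hh z).hasDerivAt
  have key := (((hg.pow 2).const_mul 216).sub ((hf.pow 3).div_const 2)).add
    ((hf.mul hh).const_mul (3 / 2))
  refine (key.congr_deriv ?_).deriv
  push_cast
  ring

theorem pd₂_eq_pd₁_of_cyclic {F : ℂ → ℂ → ℂ → ℂ} (hF : ∀ a b c, F a b c = F b c a)
    (z₁ z₂ z₃ : ℂ) : pd₂ F z₁ z₂ z₃ = pd₁ F z₂ z₃ z₁ :=
  congrArg (deriv · z₂) (funext fun t => hF z₁ t z₃)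

theorem pd₃_eq_pd₁_of_cyclic {F : ℂ → ℂ → ℂ → ℂ} (hF : ∀ a b c, F a b c = F b c a)
    (z₁ z₂ z₃ : ℂ) : pd₃ F z₁ z₂ z₃ = pd₁ F z₃ z₁ z₂ :=
  congrArg (deriv · z₃) (funext fun t => (hF t z₁ z₂).symm)

theorem C₆_cyclic (z₁ z₂ z₃ : ℂ) : C₆ z₁ z₂ z₃ = C₆ z₂ z₃ z₁ := by
  simp only [C₆]
  ring

theorem C₉_cyclic (z₁ z₂ z₃ : ℂ) : C₉ z₁ z₂ z₃ = C₉ z₂ z₃ z₁ := by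
  simp only [C₉]
  ring

theorem C₁₂_cyclic (z₁ z₂ z₃ : ℂ) : C₁₂ z₁ z₂ z₃ = C₁₂ z₂ z₃ z₁ := by
  simp only [C₁₂]
  ring

theorem C₁₈_cyclic (z₁ z₂ z₃ : ℂ) : C₁₈ z₁ z₂ z₃ = C₁₈ z₂ z₃ z₁ := by
  simp only [C₁₈]
  ring

theorem pd₁_C₁₈ (z₁ z₂ z₃ : ℂ) : pd₁ C₁₈ z₁ z₂ z₃ =
    3 / 2 * (C₁₂ z₁ z₂ z₃ - C₆ z₁ z₂ z₃ ^ 2) * pd₁ C₆ z₁ z₂ z₃ +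
      432 * C₉ z₁ z₂ z₃ * pd₁ C₉ z₁ z₂ z₃ + 3 / 2 * C₆ z₁ z₂ z₃ * pd₁ C₁₂ z₁ z₂ z₃ := by
  simp only [pd₁, C₁₈_eq]
  exact deriv_syzygy (f := fun t => C₆ t z₂ z₃) (g := fun t => C₉ t z₂ z₃)
    (h := fun t => C₁₂ t z₂ z₃) _ (by unfold C₆; fun_prop) (by unfold C₉; fun_prop)
    (by unfold C₁₂; fun_prop)

theorem pd₂_C₁₈ (z₁ z₂ z₃ : ℂ) : pd₂ C₁₈ z₁ z₂ z₃ =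
    3 / 2 * (C₁₂ z₁ z₂ z₃ - C₆ z₁ z₂ z₃ ^ 2) * pd₂ C₆ z₁ z₂ z₃ +
      432 * C₉ z₁ z₂ z₃ * pd₂ C₉ z₁ z₂ z₃ + 3 / 2 * C₆ z₁ z₂ z₃ * pd₂ C₁₂ z₁ z₂ z₃ := by
  simp only [pd₂_eq_pd₁_of_cyclic C₆_cyclic, pd₂_eq_pd₁_of_cyclic C₉_cyclic,
    pd₂_eq_pd₁_of_cyclic C₁₂_cyclic, pd₂_eq_pd₁_of_cyclic C₁₈_cyclic, pd₁_C₁₈]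
  rw [C₆_cyclic z₁, C₉_cyclic z₁, C₁₂_cyclic z₁]

theorem pd₃_C₁₈ (z₁ z₂ z₃ : ℂ) : pd₃ C₁₈ z₁ z₂ z₃ =
    3 / 2 * (C₁₂ z₁ z₂ z₃ - C₆ z₁ z₂ z₃ ^ 2) * pd₃ C₆ z₁ z₂ z₃ +
      432 * C₉ z₁ z₂ z₃ * pd₃ C₉ z₁ z₂ z₃ + 3 / 2 * C₆ z₁ z₂ z₃ * pd₃ C₁₂ z₁ z₂ z₃ := by
  simp only [pd₃_eq_pd₁_of_cyclic C₆_cyclic, pd₃_eq_pd₁_of_cyclic C₉_cyclic,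
    pd₃_eq_pd₁_of_cyclic C₁₂_cyclic, pd₃_eq_pd₁_of_cyclic C₁₈_cyclic, pd₁_C₁₈]
  rw [← C₆_cyclic z₃, ← C₉_cyclic z₃, ← C₁₂_cyclic z₃]

theorem hasDerivAt_cube (z : ℂ) : HasDerivAt (fun t : ℂ => t ^ 3) (3 * z ^ 2) z := by
  simpa using hasDerivAt_pow 3 z

theorem pd₁_C₆ (z₁ z₂ z₃ : ℂ) : pd₁ C₆ z₁ z₂ z₃ =
    6 * z₁ ^ 5 - 30 * z₁ ^ 2 * (z₂ ^ 3 + z₃ ^ 3) := by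
  have hx := hasDerivAt_cube z₁
  have key := ((hx.pow 2).sub (hx.const_mul (10 * (z₂ ^ 3 + z₃ ^ 3)))).add_const
    (z₂ ^ 6 + z₃ ^ 6 - 10 * z₂ ^ 3 * z₃ ^ 3)
  refine HasDerivAt.deriv (HasDerivAt.congr_deriv (key.congr_of_eventuallyEq ?_) ?_)
  · refine Filter.Eventually.of_forall fun t => ?_
    simp [C₆]
    ring
  · simp
    ring

theorem pd₁_C₉ (z₁ z₂ z₃ : ℂ) : pd₁ C₉ z₁ z₂ z₃ =
    3 * z₁ ^ 2 * (z₂ ^ 3 - z₃ ^ 3) * (z₂ ^ 3 + z₃ ^ 3 - 2 * z₁ ^ 3) := by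
  have hx := hasDerivAt_cube z₁
  have key := ((hx.sub_const (z₂ ^ 3)).mul (hx.const_sub (z₃ ^ 3))).const_mul (z₂ ^ 3 - z₃ ^ 3)
  refine HasDerivAt.deriv (HasDerivAt.congr_deriv (key.congr_of_eventuallyEq ?_) ?_)
  · refine Filter.Eventually.of_forall fun t => ?_
    simp [C₉]
    ring
  · simp
    ring

theorem pd₁_C₁₂ (z₁ z₂ z₃ : ℂ) : pd₁ C₁₂ z₁ z₂ z₃ =
    12 * z₁ ^ 2 * ((z₁ ^ 3 + z₂ ^ 3 + z₃ ^ 3) ^ 3 + 54 * z₁ ^ 3 * z₂ ^ 3 * z₃ ^ 3 +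
      54 * z₂ ^ 3 * z₃ ^ 3 * (z₁ ^ 3 + z₂ ^ 3 + z₃ ^ 3)) := by
  have hx := hasDerivAt_cube z₁
  have hs := hx.add_const (z₂ ^ 3 + z₃ ^ 3)
  have key := (hs.pow 4).add ((hs.mul hx).const_mul (216 * z₂ ^ 3 * z₃ ^ 3))
  refine HasDerivAt.deriv (HasDerivAt.congr_deriv (key.congr_of_eventuallyEq ?_) ?_)
  · refine Filter.Eventually.of_forall fun t => ?_
    simp [C₁₂]
    ring
  · simp
    ring

theorem pd₂_C₆ (z₁ z₂ z₃ : ℂ) : pd₂ C₆ z₁ z₂ z₃ =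
    6 * z₂ ^ 5 - 30 * z₂ ^ 2 * (z₃ ^ 3 + z₁ ^ 3) := by
  rw [pd₂_eq_pd₁_of_cyclic C₆_cyclic, pd₁_C₆]

theorem pd₂_C₉ (z₁ z₂ z₃ : ℂ) : pd₂ C₉ z₁ z₂ z₃ =
    3 * z₂ ^ 2 * (z₃ ^ 3 - z₁ ^ 3) * (z₃ ^ 3 + z₁ ^ 3 - 2 * z₂ ^ 3) := by
  rw [pd₂_eq_pd₁_of_cyclic C₉_cyclic, pd₁_C₉]

theorem pd₂_C₁₂ (z₁ z₂ z₃ : ℂ) : pd₂ C₁₂ z₁ z₂ z₃ =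
    12 * z₂ ^ 2 * ((z₁ ^ 3 + z₂ ^ 3 + z₃ ^ 3) ^ 3 + 54 * z₁ ^ 3 * z₂ ^ 3 * z₃ ^ 3 +
      54 * z₃ ^ 3 * z₁ ^ 3 * (z₁ ^ 3 + z₂ ^ 3 + z₃ ^ 3)) := by
  rw [pd₂_eq_pd₁_of_cyclic C₁₂_cyclic, pd₁_C₁₂]
  ring

theorem pd₃_C₆ (z₁ z₂ z₃ : ℂ) : pd₃ C₆ z₁ z₂ z₃ =
    6 * z₃ ^ 5 - 30 * z₃ ^ 2 * (z₁ ^ 3 + z₂ ^ 3) := by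
  rw [pd₃_eq_pd₁_of_cyclic C₆_cyclic, pd₁_C₆]

theorem pd₃_C₉ (z₁ z₂ z₃ : ℂ) : pd₃ C₉ z₁ z₂ z₃ =
    3 * z₃ ^ 2 * (z₁ ^ 3 - z₂ ^ 3) * (z₁ ^ 3 + z₂ ^ 3 - 2 * z₃ ^ 3) := by
  rw [pd₃_eq_pd₁_of_cyclic C₉_cyclic, pd₁_C₉]

theorem pd₃_C₁₂ (z₁ z₂ z₃ : ℂ) : pd₃ C₁₂ z₁ z₂ z₃ =
    12 * z₃ ^ 2 * ((z₁ ^ 3 + z₂ ^ 3 + z₃ ^ 3) ^ 3 + 54 * z₁ ^ 3 * z₂ ^ 3 * z₃ ^ 3 +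
      54 * z₁ ^ 3 * z₂ ^ 3 * (z₁ ^ 3 + z₂ ^ 3 + z₃ ^ 3)) := by
  rw [pd₃_eq_pd₁_of_cyclic C₁₂_cyclic, pd₁_C₁₂]
  ring

theorem jac_eq (F G H : ℂ → ℂ → ℂ → ℂ) (z₁ z₂ z₃ : ℂ) : jac F G H z₁ z₂ z₃ =
    pd₁ F z₁ z₂ z₃ * (pd₂ G z₁ z₂ z₃ * pd₃ H z₁ z₂ z₃ - pd₃ G z₁ z₂ z₃ * pd₂ H z₁ z₂ z₃) -
    pd₂ F z₁ z₂ z₃ * (pd₁ G z₁ z₂ z₃ * pd₃ H z₁ z₂ z₃ - pd₃ G z₁ z₂ z₃ * pd₁ H z₁ z₂ z₃) +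
    pd₃ F z₁ z₂ z₃ * (pd₁ G z₁ z₂ z₃ * pd₂ H z₁ z₂ z₃ - pd₂ G z₁ z₂ z₃ * pd₁ H z₁ z₂ z₃) := by
  simp only [jac, Matrix.det_fin_three, Matrix.of_apply, Matrix.cons_val]
  ring

theorem jac_C₆_C₉_C₁₂ (z₁ z₂ z₃ : ℂ) :
    jac C₆ C₉ C₁₂ z₁ z₂ z₃ = (-2592) * 𝔠₁₂ z₁ z₂ z₃ ^ 2 := by
  simp only [jac_eq, pd₁_C₆, pd₂_C₆, pd₃_C₆, pd₁_C₉, pd₂_C₉, pd₃_C₉,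
    pd₁_C₁₂, pd₂_C₁₂, pd₃_C₁₂, 𝔠₁₂]
  ring

theorem jac_C₆_C₉_C₁₈ (z₁ z₂ z₃ : ℂ) :
    jac C₆ C₉ C₁₈ z₁ z₂ z₃ = 3 / 2 * C₆ z₁ z₂ z₃ * jac C₆ C₉ C₁₂ z₁ z₂ z₃ := by
  simp only [jac_eq, pd₁_C₁₈, pd₂_C₁₈, pd₃_C₁₈]
  ring

theorem jac_C₆_C₁₂_C₁₈ (z₁ z₂ z₃ : ℂ) :
    jac C₆ C₁₂ C₁₈ z₁ z₂ z₃ = -432 * C₉ z₁ z₂ z₃ * jac C₆ C₉ C₁₂ z₁ z₂ z₃ := by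
  simp only [jac_eq, pd₁_C₁₈, pd₂_C₁₈, pd₃_C₁₈]
  ring

theorem jac_C₉_C₁₂_C₁₈ (z₁ z₂ z₃ : ℂ) : jac C₉ C₁₂ C₁₈ z₁ z₂ z₃ =
    3 / 2 * (C₁₂ z₁ z₂ z₃ - C₆ z₁ z₂ z₃ ^ 2) * jac C₆ C₉ C₁₂ z₁ z₂ z₃ := by
  simp only [jac_eq, pd₁_C₁₈, pd₂_C₁₈, pd₃_C₁₈]
  ring

theorem invariants_from_jacobians (z₁ z₂ z₃ : ℂ) (h : 𝔠₁₂ z₁ z₂ z₃ ≠ 0) :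
    jac C₆ C₉ C₁₂ z₁ z₂ z₃ ≠ 0 ∧
    C₆ z₁ z₂ z₃ = (2/3) * jac C₆ C₉ C₁₈ z₁ z₂ z₃ / jac C₆ C₉ C₁₂ z₁ z₂ z₃ ∧
    C₉ z₁ z₂ z₃ = -(1/432) * jac C₆ C₁₂ C₁₈ z₁ z₂ z₃ / jac C₆ C₉ C₁₂ z₁ z₂ z₃ ∧
    C₁₂ z₁ z₂ z₃ = (2/3) * jac C₉ C₁₂ C₁₈ z₁ z₂ z₃ / jac C₆ C₉ C₁₂ z₁ z₂ z₃
      + (4/9) * (jac C₆ C₉ C₁₈ z₁ z₂ z₃)^2 / (jac C₆ C₉ C₁₂ z₁ z₂ z₃)^2 := by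
  have hJ : jac C₆ C₉ C₁₂ z₁ z₂ z₃ ≠ 0 := by
    rw [jac_C₆_C₉_C₁₂]
    exact mul_ne_zero (by norm_num) (pow_ne_zero 2 h)
  refine ⟨hJ, ?_, ?_, ?_⟩
  · rw [jac_C₆_C₉_C₁₈]
    field_simp
  · rw [jac_C₆_C₁₂_C₁₈]
    field_simp
  · rw [jac_C₉_C₁₂_C₁₈, jac_C₆_C₉_C₁₈]
    field_simp
    ring
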